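/- arXiv:1711.01660 — 2 statements merged into one kernel-verified Lean document; each statement's English description precedes it below -/
import Mathlib

section
/- Let F be the multilinear extension of a nonnegative monotone submodular set function f on ground set V = {1,…,n}, let r be the rank of the matroid I, and let m_f := max_{i ∈ {1,…,n}} f({i}). If x ∈ [0,1]ⁿ and v ∈ {0,1}ⁿ is a 0–1 vector with at most r ones such that x + v/T ∈ [0,1]ⁿ, then for every coordinate j ∈ {1,…,n}: |∂_j F(x + v/T) − ∂_j F(x)| ≤ m_f·√r·‖v/T‖, i.e. along such SCG ascent directions the gradient of F is m_f√r-Lipschitz coordinatewise. -/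
/-- The multilinear extension `F(x) = Σ_{S ⊆ V} f(S) ∏_{i∈S} x_i ∏_{j∉S} (1 − x_j)`
of a set function `f` on the ground set `V = {1,…,n}`. -/
noncomputable def multilinearExt {n : ℕ} (f : Finset (Fin n) → ℝ)
    (x : EuclideanSpace ℝ (Fin n)) : ℝ :=
  ∑ S : Finset (Fin n), f S * ((∏ i ∈ S, x i) * ∏ j ∈ Sᶜ, (1 - x j))

/-- The discrete derivative of a set function `f` in direction `j`. -/
def marginal {n : ℕ} (f : Finset (Fin n) → ℝ) (j : Fin n) (R : Finset (Fin n)) : ℝ :=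
  f (insert j R) - f (R.erase j)

theorem multilinearExt_eq_sum_powerset_erase {n : ℕ} (f : Finset (Fin n) → ℝ) (j : Fin n)
    (x : EuclideanSpace ℝ (Fin n)) :
    multilinearExt f x = ∑ R ∈ (Finset.univ.erase j).powerset,
      (f R * (1 - x j) + f (insert j R) * x j) *
        ((∏ i ∈ R, x i) * ∏ i ∈ (insert j R)ᶜ, (1 - x i)) := by
  have hu : (Finset.univ : Finset (Finset (Fin n))) =
      (insert j (Finset.univ.erase j)).powerset := by
    rw [Finset.insert_erase (Finset.mem_univ j), Finset.powerset_univ]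
  rw [multilinearExt, hu, Finset.sum_powerset_insert (Finset.notMem_erase j _),
    ← Finset.sum_add_distrib]
  refine Finset.sum_congr rfl fun R hR => ?_
  have hj : j ∉ R := fun h => Finset.notMem_erase j _ (Finset.mem_powerset.mp hR h)
  have hc : Rᶜ = insert j (insert j R)ᶜ := by
    ext i
    by_cases h : i = j <;> simp [h, hj]
  rw [hc, Finset.prod_insert (by simp), Finset.prod_insert hj]
  ring

theorem multilinearExt_add_smul_single {n : ℕ} (f : Finset (Fin n) → ℝ) (j : Fin n)
    (x : EuclideanSpace ℝ (Fin n)) (t : ℝ) :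
    multilinearExt f (x + t • EuclideanSpace.single j 1) =
      multilinearExt f x + t * multilinearExt (marginal f j) x := by
  simp only [multilinearExt_eq_sum_powerset_erase _ j, Finset.mul_sum, ← Finset.sum_add_distrib]
  refine Finset.sum_congr rfl fun R hR => ?_
  have hj : j ∉ R := fun h => Finset.notMem_erase j _ (Finset.mem_powerset.mp hR h)
  have hne : ∀ i, i ≠ j → (x + t • EuclideanSpace.single j (1 : ℝ)) i = x i := by
    intro i hi
    simp [hi]
  have h1 : ∏ i ∈ R, (x + t • EuclideanSpace.single j (1 : ℝ)) i = ∏ i ∈ R, x i :=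
    Finset.prod_congr rfl fun i hi => hne i (ne_of_mem_of_not_mem hi hj)
  have h2 : ∏ i ∈ (insert j R)ᶜ, (1 - (x + t • EuclideanSpace.single j (1 : ℝ)) i) =
      ∏ i ∈ (insert j R)ᶜ, (1 - x i) := by
    refine Finset.prod_congr rfl fun i hi => ?_
    rw [hne i]
    rintro rfl
    simp at hi
  have h3 : (x + t • EuclideanSpace.single j (1 : ℝ)) j = x j + t := by simp
  rw [h1, h2, h3]
  simp only [marginal, Finset.insert_idem, Finset.erase_insert hj, Finset.erase_eq_of_notMem hj]
  ring

theorem differentiable_multilinearExt {n : ℕ} (f : Finset (Fin n) → ℝ) :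
    Differentiable ℝ (multilinearExt f) := by
  unfold multilinearExt
  fun_prop

theorem fderiv_multilinearExt_single {n : ℕ} (f : Finset (Fin n) → ℝ) (j : Fin n)
    (x : EuclideanSpace ℝ (Fin n)) :
    fderiv ℝ (multilinearExt f) x (EuclideanSpace.single j 1) =
      multilinearExt (marginal f j) x := by
  rw [← (differentiable_multilinearExt f x).lineDeriv_eq_fderiv, lineDeriv]
  simp only [multilinearExt_add_smul_single]
  simp

theorem abs_multilinearExt_le {n : ℕ} {g : Finset (Fin n) → ℝ} {c : ℝ} (hg : ∀ R, |g R| ≤ c)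
    {x : EuclideanSpace ℝ (Fin n)} (hx : ∀ i, x i ∈ Set.Icc (0 : ℝ) 1) :
    |multilinearExt g x| ≤ c := by
  have hw : ∑ R : Finset (Fin n), ((∏ i ∈ R, x i) * ∏ i ∈ Rᶜ, (1 - x i)) = 1 := by
    have h := Finset.prod_add (fun i => x i) (fun i => 1 - x i) Finset.univ
    simpa [Finset.compl_eq_univ_sdiff] using h.symm
  calc |multilinearExt g x|
      ≤ ∑ R : Finset (Fin n), |g R * ((∏ i ∈ R, x i) * ∏ i ∈ Rᶜ, (1 - x i))| :=
        Finset.abs_sum_le_sum_abs _ _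
    _ ≤ ∑ R : Finset (Fin n), c * ((∏ i ∈ R, x i) * ∏ i ∈ Rᶜ, (1 - x i)) := by
        refine Finset.sum_le_sum fun R _ => ?_
        have h0 : 0 ≤ (∏ i ∈ R, x i) * ∏ i ∈ Rᶜ, (1 - x i) :=
          mul_nonneg (Finset.prod_nonneg fun i _ => (hx i).1)
            (Finset.prod_nonneg fun i _ => sub_nonneg.mpr (hx i).2)
        rw [abs_mul, abs_of_nonneg h0]
        exact mul_le_mul_of_nonneg_right (hg R) h0
    _ = c := by rw [← Finset.mul_sum, hw, mul_one]

theorem abs_multilinearExt_add_sub_le {n : ℕ} {g : Finset (Fin n) → ℝ} {c t : ℝ} (ht : 0 ≤ t)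
    (hg : ∀ i R, |marginal g i R| ≤ c) {x : EuclideanSpace ℝ (Fin n)}
    (hx : ∀ i, x i ∈ Set.Icc (0 : ℝ) 1) (A : Finset (Fin n)) (hA : ∀ i ∈ A, x i + t ≤ 1) :
    |multilinearExt g (x + t • ∑ i ∈ A, EuclideanSpace.single i 1) - multilinearExt g x| ≤
      A.card * (t * c) := by
  induction A using Finset.induction_on with
  | empty => simp
  | insert a A ha ih =>
    have ih := ih fun i hi => hA i (Finset.mem_insert_of_mem hi)
    set y := x + t • ∑ i ∈ A, EuclideanSpace.single i (1 : ℝ) with hy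
    have hyi : ∀ i, y i = x i + if i ∈ A then t else 0 := by
      intro i
      simp [hy, Pi.single_apply]
    have hyc : ∀ i, y i ∈ Set.Icc (0 : ℝ) 1 := by
      intro i
      rw [hyi]
      split_ifs with h
      · exact ⟨add_nonneg (hx i).1 ht, hA i (Finset.mem_insert_of_mem h)⟩
      · simpa using hx i
    have hs : x + t • ∑ i ∈ insert a A, EuclideanSpace.single i (1 : ℝ) =
        y + t • EuclideanSpace.single a 1 := by
      rw [Finset.sum_insert ha, hy, smul_add]
      abel
    rw [hs, multilinearExt_add_smul_single, Finset.card_insert_of_notMem ha]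
    have hstep : |t * multilinearExt (marginal g a) y| ≤ t * c := by
      rw [abs_mul, abs_of_nonneg ht]
      exact mul_le_mul_of_nonneg_left (abs_multilinearExt_le (hg a) hyc) ht
    calc _ = |(multilinearExt g y - multilinearExt g x) +
          t * multilinearExt (marginal g a) y| := by congr 1; ring
      _ ≤ A.card * (t * c) + t * c := (abs_add_le _ _).trans (add_le_add ih hstep)
      _ = _ := by push_cast; ring

theorem marginal_mem_Icc {n : ℕ} {f : Finset (Fin n) → ℝ} (hf_nonneg : ∀ S, 0 ≤ f S)
    (hf_mono : ∀ A B : Finset (Fin n), A ⊆ B → f A ≤ f B)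
    (hf_submod : ∀ A B : Finset (Fin n), f (A ∩ B) + f (A ∪ B) ≤ f A + f B)
    (j : Fin n) (R : Finset (Fin n)) : marginal f j R ∈ Set.Icc 0 (f {j}) := by
  have h1 := hf_mono (R.erase j) (insert j R)
    ((Finset.erase_subset j R).trans (Finset.subset_insert j R))
  have h2 := hf_submod {j} (R.erase j)
  have h3 : {j} ∪ R.erase j = insert j R := by
    rw [← Finset.insert_eq]
    ext i
    by_cases h : i = j <;> simp [h]
  rw [h3] at h2
  have h4 := hf_nonneg ({j} ∩ R.erase j)
  constructor <;> simp only [marginal] <;> linarith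

/-- Lemma 3 of the paper.  Let `F` be the multilinear extension of a
nonnegative monotone submodular set function `f`, let `r` bound the number of ones of the
0–1 vector `v` (an extreme point of a rank-`r` matroid polytope), and let
`m_f = max_i f({i})`.  If `x ∈ [0,1]ⁿ` and `x + v/T ∈ [0,1]ⁿ`, then for every coordinate `j`,
`|∂_j F(x + v/T) − ∂_j F(x)| ≤ m_f·√r·‖v/T‖`. -/
theorem stmt3 {n : ℕ} (f : Finset (Fin n) → ℝ)
    (hf_nonneg : ∀ S, 0 ≤ f S)
    (hf_mono : ∀ A B : Finset (Fin n), A ⊆ B → f A ≤ f B)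
    (hf_submod : ∀ A B : Finset (Fin n), f (A ∩ B) + f (A ∪ B) ≤ f A + f B)
    (r T : ℕ) (hT : 1 ≤ T)
    (mf : ℝ) (hmf : mf = sSup (Set.range fun i : Fin n => f {i}))
    (x v : EuclideanSpace ℝ (Fin n))
    -- `v` is a 0–1 vector with at most `r` ones
    (S : Finset (Fin n)) (hS_card : S.card ≤ r)
    (hv : ∀ i, v i = if i ∈ S then 1 else 0)
    (hx : ∀ i, x i ∈ Set.Icc (0 : ℝ) 1)
    (hxv : ∀ i, (x + (T : ℝ)⁻¹ • v) i ∈ Set.Icc (0 : ℝ) 1)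
    (j : Fin n) :
    |fderiv ℝ (multilinearExt f) (x + (T : ℝ)⁻¹ • v) (EuclideanSpace.single j 1)
        - fderiv ℝ (multilinearExt f) x (EuclideanSpace.single j 1)|
      ≤ mf * Real.sqrt r * ‖(T : ℝ)⁻¹ • v‖ := by
  have ht : (0 : ℝ) ≤ (T : ℝ)⁻¹ := by positivity
  have hm : f {j} ≤ mf := hmf ▸ le_csSup (Set.finite_range _).bddAbove ⟨j, rfl⟩
  have hm0 : 0 ≤ mf := (hf_nonneg _).trans hm
  have hg : ∀ i R, |marginal (marginal f j) i R| ≤ mf := by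
    intro i R
    have h1 := marginal_mem_Icc hf_nonneg hf_mono hf_submod j (insert i R)
    have h2 := marginal_mem_Icc hf_nonneg hf_mono hf_submod j (R.erase i)
    rw [marginal, abs_le]
    constructor <;> linarith [h1.1, h1.2, h2.1, h2.2]
  have hvs : v = ∑ i ∈ S, EuclideanSpace.single i (1 : ℝ) := by
    ext i
    simp [hv, Pi.single_apply]
  have hnorm : ‖v‖ = Real.sqrt S.card := by
    rw [EuclideanSpace.norm_eq]
    simp [hv]
  have hS : ∀ i ∈ S, x i + (T : ℝ)⁻¹ ≤ 1 := by
    intro i hi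
    simpa [hv, hi] using (hxv i).2
  rw [fderiv_multilinearExt_single, fderiv_multilinearExt_single, norm_smul, hnorm,
    Real.norm_of_nonneg ht, hvs]
  refine (abs_multilinearExt_add_sub_le ht hg hx S hS).trans ?_
  have hsq : (S.card : ℝ) ≤ Real.sqrt r * Real.sqrt S.card := by
    nth_rewrite 1 [← Real.mul_self_sqrt (Nat.cast_nonneg S.card)]
    gcongr
  calc (S.card : ℝ) * ((T : ℝ)⁻¹ * mf)
      ≤ (Real.sqrt r * Real.sqrt S.card) * ((T : ℝ)⁻¹ * mf) := by gcongr
    _ = mf * Real.sqrt r * ((T : ℝ)⁻¹ * Real.sqrt S.card) := by ring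
end

section
/- Let σ, L, D ≥ 0 and let s ≥ 8 be a real number. Suppose (a_t)_{t≥0} is a sequence of nonnegative reals satisfying, for every t ≥ 1, a_t ≤ (1 − 2/(t+s)^{2/3})·a_{t−1} + (16σ² + 3L²D²)/(t+s)^{4/3}. Then for every t ≥ 0: a_t ≤ Q/(t+s+1)^{2/3}, where Q := max{ a₀·(s+1)^{2/3}, 16σ² + 3L²D² }. -/
theorem add_one_rpow_two_thirds_le {x : ℝ} (hx : 0 ≤ x) :
    (x + 1) ^ ((2 : ℝ) / 3) ≤ x ^ ((2 : ℝ) / 3) + 1 := by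
  simpa using Real.rpow_add_le_add_rpow hx zero_le_one
    (by norm_num : (0 : ℝ) ≤ 2 / 3) (by norm_num)

theorem two_le_rpow_two_thirds {x : ℝ} (hx : 8 ≤ x) : 2 ≤ x ^ ((2 : ℝ) / 3) := by
  have h : (8 : ℝ) ^ ((2 : ℝ) / 3) = 4 := by
    rw [show (8 : ℝ) = 2 ^ (3 : ℝ) by norm_num, ← Real.rpow_mul (by norm_num)]
    norm_num
  have h' : (8 : ℝ) ^ ((2 : ℝ) / 3) ≤ x ^ ((2 : ℝ) / 3) := by gcongr
  linarith

theorem rpow_four_thirds {x : ℝ} (hx : 0 ≤ x) :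
    x ^ ((4 : ℝ) / 3) = (x ^ ((2 : ℝ) / 3)) ^ 2 := by
  rw [← Real.rpow_mul_natCast hx]
  norm_num

theorem contraction_step_le {p q Q : ℝ} (hp : 2 ≤ p) (hq : 0 < q) (hqp : q ≤ p + 1)
    (hQ : 0 ≤ Q) : (1 - 2 / p) * (Q / p) + Q / p ^ 2 ≤ Q / q := by
  have hp0 : 0 < p := by linarith
  have h : (1 - 2 / p) * (Q / p) + Q / p ^ 2 = Q * (p - 1) / p ^ 2 := by
    field_simp
    ring
  rw [h, div_le_div_iff₀ (by positivity) hq, mul_assoc]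
  exact mul_le_mul_of_nonneg_left (by nlinarith) hQ

/-- resolution of the SCG gradient-error recursion.
Let `σ, L, D ≥ 0` and `s ≥ 8`.  If a sequence `a` of nonnegative reals satisfies
`a t ≤ (1 - 2/(t+s)^(2/3)) * a (t-1) + (16σ² + 3L²D²)/(t+s)^(4/3)` for every `t ≥ 1`,
then `a t ≤ Q / (t+s+1)^(2/3)` for every `t ≥ 0`, where
`Q = max (a 0 * (s+1)^(2/3)) (16σ² + 3L²D²)`. -/
theorem stmt7 (σ L D s : ℝ) (hσ : 0 ≤ σ) (hL : 0 ≤ L) (hD : 0 ≤ D) (hs : 8 ≤ s)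
    (a : ℕ → ℝ) (ha_nonneg : ∀ t, 0 ≤ a t)
    (hrec : ∀ t : ℕ, 1 ≤ t →
      a t ≤ (1 - 2 / ((t : ℝ) + s) ^ ((2 : ℝ) / 3)) * a (t - 1)
        + (16 * σ ^ 2 + 3 * L ^ 2 * D ^ 2) / ((t : ℝ) + s) ^ ((4 : ℝ) / 3)) :
    ∀ t : ℕ,
      a t ≤ max (a 0 * (s + 1) ^ ((2 : ℝ) / 3)) (16 * σ ^ 2 + 3 * L ^ 2 * D ^ 2)
        / ((t : ℝ) + s + 1) ^ ((2 : ℝ) / 3) := by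
  intro t
  set C := 16 * σ ^ 2 + 3 * L ^ 2 * D ^ 2
  set Q := max (a 0 * (s + 1) ^ ((2 : ℝ) / 3)) C
  have hQ : 0 ≤ Q := le_max_of_le_right (by positivity)
  induction t with
  | zero =>
    rw [le_div_iff₀ (by positivity)]
    rw [Nat.cast_zero, zero_add]
    exact le_max_left _ _
  | succ n ih =>
    have hx : 8 ≤ ((n + 1 : ℕ) : ℝ) + s := by linarith [(n + 1).cast_nonneg (α := ℝ)]
    have hr := hrec (n + 1) n.succ_pos
    rw [rpow_four_thirds (by linarith), Nat.add_sub_cancel] at hr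
    rw [show (n : ℝ) + s + 1 = ((n + 1 : ℕ) : ℝ) + s by push_cast; ring] at ih
    have hp := two_le_rpow_two_thirds hx
    have hqp := add_one_rpow_two_thirds_le (by linarith : 0 ≤ ((n + 1 : ℕ) : ℝ) + s)
    refine hr.trans (le_trans ?_ (contraction_step_le hp (by positivity) hqp hQ))
    have hc : 0 ≤ 1 - 2 / (((n + 1 : ℕ) : ℝ) + s) ^ ((2 : ℝ) / 3) :=
      sub_nonneg.2 ((div_le_one (by linarith)).2 hp)
    have hCQ : C ≤ Q := le_max_right _ _
    gcongr
end
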